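/- Fix ρ > 0 and integers M > m ≥ 0. Then for every integer N ≥ 1 and every vector c = (c_0, …, c_{N−1}) of positive reals, 𝒞(c; z^{N+m}; N, ρ) ≤ ((M+1)!/(m+1)!)² · ρ^{m−M} · N^{−2(M−m)} · 𝒞(c; z^{N+M}; N, ρ). Consequently, for any choice of vectors c^{(N)} ∈ (0,∞)^N (one for each N), lim_{N→∞} 𝒞(c^{(N)}; z^{N+M}; N, ρ)^{−1} · Σ_{m'=0}^{M} 𝒞(c^{(N)}; z^{N+m'}; N, ρ) = 1. -/

import Mathlib

noncomputable section

/-- The constant `𝒞(c; z^M; N, ρ)`. -/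
def CC (N : ℕ) (c : Fin N → ℝ) (M : ℕ) (ρ : ℝ) : ℝ :=
  ∑ j : Fin N, (M.choose j : ℝ) ^ 2 * ((M - (j : ℕ) - 1).choose (N - (j : ℕ) - 1) : ℝ) ^ 2
    * ρ ^ (M - (j : ℕ)) / c j

lemma mul_choose_mul_choose_le (N m j : ℕ) (hj : j < N) :
    N * ((N + m).choose j * (N + m - j - 1).choose (N - j - 1)) ≤
      (m + 2) * ((N + (m + 1)).choose j * (N + (m + 1) - j - 1).choose (N - j - 1)) := by
  obtain ⟨i, rfl⟩ : ∃ i, N = j + i + 1 := ⟨N - j - 1, by omega⟩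
  have e1 : j + i + 1 + m - j - 1 = i + m := by omega
  have e2 : j + i + 1 - j - 1 = i := by omega
  have e3 : j + i + 1 + (m + 1) - j - 1 = i + m + 1 := by omega
  have h1 := Nat.choose_mul_succ_eq (j + i + 1 + m) j
  have h2 := Nat.choose_mul_succ_eq (i + m) i
  have e4 : j + i + 1 + m + 1 - j = i + m + 2 := by omega
  have e5 : i + m + 1 - i = m + 1 := by omega
  rw [e4] at h1
  rw [e5] at h2
  rw [e1, e2, e3, ← add_assoc (j + i + 1) m 1]
  generalize (j + i + 1 + m).choose j = a at *
  generalize (j + i + 1 + m + 1).choose j = a' at *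
  generalize (i + m).choose i = b at *
  generalize (i + m + 1).choose i = b' at *
  refine Nat.le_of_mul_le_mul_left (c := (i + m + 2) * (m + 1)) ?_ (by positivity)
  calc (i + m + 2) * (m + 1) * ((j + i + 1) * (a * b))
      = ((i + m + 2) * (m + 1)) * (j + i + 1) * (a * b) := by ring
    _ ≤ ((m + 2) * (i + m + 1)) * (j + i + 1 + m + 1) * (a * b) := by
        gcongr ?_ * ?_ * _
        · nlinarith
        · omega
    _ = (m + 2) * ((a * (j + i + 1 + m + 1)) * (b * (i + m + 1))) := by ring
    _ = (i + m + 2) * (m + 1) * ((m + 2) * (a' * b')) := by rw [h1, h2]; ring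

lemma CC_succ_bound {ρ : ℝ} (hρ : 0 < ρ) (N m : ℕ) (c : Fin N → ℝ) (hc : ∀ j, 0 < c j) :
    (N : ℝ) ^ 2 * ρ * CC N c (N + m) ρ ≤ ((m : ℝ) + 2) ^ 2 * CC N c (N + (m + 1)) ρ := by
  unfold CC
  rw [Finset.mul_sum, Finset.mul_sum]
  refine Finset.sum_le_sum fun j _ => ?_
  have h : (N : ℝ) * (((N + m).choose j : ℝ) * ((N + m - j - 1).choose (N - j - 1) : ℝ)) ≤
      ((m : ℝ) + 2) * (((N + (m + 1)).choose j : ℝ) *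
        ((N + (m + 1) - j - 1).choose (N - j - 1) : ℝ)) := by
    exact_mod_cast mul_choose_mul_choose_le N m j j.2
  have h2 := pow_le_pow_left₀ (by positivity) h 2
  have e : N + (m + 1) - (j : ℕ) = (N + m - j) + 1 := by have := j.2; omega
  have hcj := hc j
  have h3 := mul_le_mul_of_nonneg_right h2
    (show 0 ≤ ρ ^ (N + m - (j : ℕ) + 1) / c j by positivity)
  rw [e] at h3 ⊢
  refine le_trans (le_of_eq ?_) (h3.trans (le_of_eq ?_))
  · ring
  · ring

lemma CC_add_bound {ρ : ℝ} (hρ : 0 < ρ) (N m d : ℕ) (c : Fin N → ℝ) (hc : ∀ j, 0 < c j) :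
    (N : ℝ) ^ (2 * d) * ρ ^ d * ((m + 1).factorial : ℝ) ^ 2 * CC N c (N + m) ρ ≤
      ((m + d + 1).factorial : ℝ) ^ 2 * CC N c (N + (m + d)) ρ := by
  induction d with
  | zero => simp
  | succ d ih =>
    have h := CC_succ_bound hρ N (m + d) c hc
    have hf : ((m + (d + 1) + 1).factorial : ℝ) =
        ((m + d : ℕ) + 2 : ℝ) * ((m + d + 1).factorial : ℝ) := by
      rw [← add_assoc m d 1, Nat.factorial_succ (m + d + 1)]
      push_cast
      ring
    calc _ = (N : ℝ) ^ 2 * ρ * ((N : ℝ) ^ (2 * d) * ρ ^ d * ((m + 1).factorial : ℝ) ^ 2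
            * CC N c (N + m) ρ) := by ring
      _ ≤ (N : ℝ) ^ 2 * ρ * (((m + d + 1).factorial : ℝ) ^ 2 * CC N c (N + (m + d)) ρ) := by
          gcongr
      _ = ((m + d + 1).factorial : ℝ) ^ 2 * ((N : ℝ) ^ 2 * ρ * CC N c (N + (m + d)) ρ) := by ring
      _ ≤ ((m + d + 1).factorial : ℝ) ^ 2 *
            (((m + d : ℕ) + 2 : ℝ) ^ 2 * CC N c (N + (m + d + 1)) ρ) := by gcongr
      _ = _ := by rw [hf, ← add_assoc m d 1]; ring

lemma CC_le {ρ : ℝ} (hρ : 0 < ρ) {M m : ℕ} (hmM : m < M) (N : ℕ) (hN : 1 ≤ N)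
    (c : Fin N → ℝ) (hc : ∀ j, 0 < c j) :
    CC N c (N + m) ρ ≤ (((M + 1).factorial : ℝ) / ((m + 1).factorial : ℝ)) ^ 2
      * ρ ^ ((m : ℤ) - (M : ℤ)) * ((N : ℝ) ^ (2 * (M - m)))⁻¹ * CC N c (N + M) ρ := by
  obtain ⟨d, rfl⟩ := Nat.exists_eq_add_of_le hmM.le
  have h := CC_add_bound hρ N m d c hc
  have hN' : (0 : ℝ) < N := by exact_mod_cast hN
  have hf : (0 : ℝ) < (m + 1).factorial := by exact_mod_cast Nat.factorial_pos _
  have e : (m : ℤ) - ((m + d : ℕ) : ℤ) = -(d : ℤ) := by push_cast; ring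
  rw [e, zpow_neg, zpow_natCast, Nat.add_sub_cancel_left]
  rw [← le_div_iff₀' (by positivity)] at h
  refine h.trans (le_of_eq ?_)
  field_simp

lemma CC_pos {ρ : ℝ} (hρ : 0 < ρ) (N M : ℕ) (hN : 1 ≤ N) (c : Fin N → ℝ)
    (hc : ∀ j, 0 < c j) : 0 < CC N c (N + M) ρ := by
  have : Nonempty (Fin N) := ⟨⟨0, hN⟩⟩
  refine Finset.sum_pos (fun j _ => ?_) Finset.univ_nonempty
  have hj := j.2
  have h1 : (0 : ℝ) < (N + M).choose j := by exact_mod_cast Nat.choose_pos (by omega)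
  have h2 : (0 : ℝ) < (N + M - j - 1).choose (N - j - 1) := by
    exact_mod_cast Nat.choose_pos (by omega)
  have hcj := hc j
  positivity

lemma tendsto_CC_ratio {ρ : ℝ} (hρ : 0 < ρ) {M m : ℕ} (hmM : m < M)
    (c : (N : ℕ) → Fin N → ℝ) (hc : ∀ N j, 0 < c N j) :
    Filter.Tendsto (fun N : ℕ => (CC N (c N) (N + M) ρ)⁻¹ * CC N (c N) (N + m) ρ)
      Filter.atTop (nhds 0) := by
  have hlim : Filter.Tendsto (fun N : ℕ =>
      (((M + 1).factorial : ℝ) / ((m + 1).factorial : ℝ)) ^ 2 * ρ ^ ((m : ℤ) - (M : ℤ))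
        * ((N : ℝ) ^ (2 * (M - m)))⁻¹) Filter.atTop (nhds 0) := by
    have h : Filter.Tendsto (fun N : ℕ => ((N : ℝ) ^ (2 * (M - m)))⁻¹) Filter.atTop (nhds 0) :=
      ((Filter.tendsto_pow_atTop (by omega)).comp tendsto_natCast_atTop_atTop).inv_tendsto_atTop
    simpa using h.const_mul
      ((((M + 1).factorial : ℝ) / ((m + 1).factorial : ℝ)) ^ 2 * ρ ^ ((m : ℤ) - (M : ℤ)))
  refine tendsto_of_tendsto_of_tendsto_of_le_of_le' tendsto_const_nhds hlim ?_ ?_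
  · filter_upwards [Filter.eventually_ge_atTop 1] with N hN
    have h1 := CC_pos hρ N M hN (c N) (hc N)
    have h2 := CC_pos hρ N m hN (c N) (hc N)
    positivity
  · filter_upwards [Filter.eventually_ge_atTop 1] with N hN
    rw [inv_mul_le_iff₀' (CC_pos hρ N M hN (c N) (hc N))]
    exact CC_le hρ hmM N hN (c N) (hc N)

theorem stmt_5 (ρ : ℝ) (hρ : 0 < ρ) (M m : ℕ) (hmM : m < M) :
    (∀ N : ℕ, 1 ≤ N → ∀ c : Fin N → ℝ, (∀ j, 0 < c j) →
      CC N c (N + m) ρ ≤ (((M + 1).factorial : ℝ) / ((m + 1).factorial : ℝ)) ^ 2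
        * ρ ^ ((m : ℤ) - (M : ℤ)) * ((N : ℝ) ^ (2 * (M - m)))⁻¹ * CC N c (N + M) ρ)
    ∧ ∀ c : (N : ℕ) → Fin N → ℝ, (∀ N j, 0 < c N j) →
      Filter.Tendsto (fun N : ℕ =>
          (CC N (c N) (N + M) ρ)⁻¹ * ∑ m' ∈ Finset.range (M + 1), CC N (c N) (N + m') ρ)
        Filter.atTop (nhds 1) := by
  refine ⟨fun N hN c hc => CC_le hρ hmM N hN c hc, fun c hc => ?_⟩
  have hsum : Filter.Tendsto (fun N : ℕ => ∑ m' ∈ Finset.range M,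
      (CC N (c N) (N + M) ρ)⁻¹ * CC N (c N) (N + m') ρ) Filter.atTop (nhds 0) := by
    simpa using tendsto_finsetSum (Finset.range M) fun m' hm' =>
      tendsto_CC_ratio hρ (Finset.mem_range.1 hm') c hc
  have hlim := hsum.add_const 1
  rw [zero_add] at hlim
  refine hlim.congr' ?_
  filter_upwards [Filter.eventually_ge_atTop 1] with N hN
  rw [Finset.sum_range_succ, mul_add, Finset.mul_sum,
    inv_mul_cancel₀ (CC_pos hρ N M hN (c N) (hc N)).ne']
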